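/- arXiv:2007.08147 — 2 statements merged into one kernel-verified Lean document; each statement's English description precedes it below -/
import Mathlib

section
/- Let U be a numeration system satisfying (H1), (H2) and (H3) that is linear with coefficients a_0,…,a_{k−1}, the recurrence holding for all i ≥ N. Let p be a prime with p > max{|a_0|, U_N}. Let X ⊆ ℕ be an ultimately periodic set with period π_X = p^μ·r where μ ≥ 1 and p does not divide r. Then every deterministic finite automaton accepting rep_U(X) has at least p^μ states. -/
/-- The `U`-numerical value of a word over `ℕ`, most significant digit first. -/
def valU (U : ℕ → ℕ) (w : List ℕ) : ℕ :=
  ∑ i ∈ Finset.range w.length, w.reverse.getD i 0 * U i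

/-- `w` is a greedy `U`-representation. -/
def IsGreedyRep (U : ℕ → ℕ) (w : List ℕ) : Prop :=
  w.head? ≠ some 0 ∧
    ∀ t < w.length, ∑ i ∈ Finset.range (t + 1), w.reverse.getD i 0 * U i < U (t + 1)

/-- `U` is a numeration system. -/
structure IsNumSys (U : ℕ → ℕ) : Prop where
  mono : StrictMono U
  base : U 0 = 1
  ratio : ∃ C : ℕ, ∀ i, U (i + 1) ≤ C * U i

/-- The language `rep_U(X)`. -/
def repLang (U : ℕ → ℕ) (X : Set ℕ) : Language ℕ :=
  {w | IsGreedyRep U w ∧ valU U w ∈ X}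

/-- A language is regular if it is accepted by a DFA with finitely many states. -/
def IsRegularLang {α : Type} (L : Language α) : Prop :=
  ∃ (σ : Type) (_ : Fintype σ) (M : DFA α σ), M.accepts = L

/-- (H2): `limsup (U (i+1) - U i) = +∞`. -/
def GapsUnbounded (U : ℕ → ℕ) : Prop :=
  ∀ B : ℕ, ∃ᶠ i in Filter.atTop, B ≤ U (i + 1) - U i

/-- (H3): the gap sequence is ultimately non-decreasing. -/
def GapsUltNondecreasing (U : ℕ → ℕ) : Prop :=
  ∃ G : ℕ, ∀ i ≥ G, U (i + 1) - U i ≤ U (i + 2) - U (i + 1)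

/-- `p` is a period of `X` from index `a` on. -/
def PeriodFrom (X : Set ℕ) (a p : ℕ) : Prop := ∀ n, a ≤ n → (n ∈ X ↔ n + p ∈ X)

/-- `X` is ultimately periodic with (minimal) period `p`. -/
def HasMinPeriod (X : Set ℕ) (p : ℕ) : Prop :=
  1 ≤ p ∧ (∃ a, PeriodFrom X a p) ∧ ∀ q, 1 ≤ q → (∃ a, PeriodFrom X a q) → p ≤ q

/-- Every suffix of `w` has `U`-value below the next term of `U`. -/
def SuffixBounded (U : ℕ → ℕ) (w : List ℕ) : Prop :=
  ∀ t < w.length, ∑ i ∈ Finset.range (t + 1), w.reverse.getD i 0 * U i < U (t + 1)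

lemma valU_nil (U : ℕ → ℕ) : valU U [] = 0 := by simp [valU]

lemma sum_range_cons_eq (U : ℕ → ℕ) (d : ℕ) (w : List ℕ) {t : ℕ} (ht : t ≤ w.length) :
    ∑ i ∈ Finset.range t, (d :: w).reverse.getD i 0 * U i =
      ∑ i ∈ Finset.range t, w.reverse.getD i 0 * U i := by
  refine Finset.sum_congr rfl fun i hi => ?_
  have hi' := Finset.mem_range.1 hi
  rw [List.reverse_cons, List.getD_append _ _ _ _ (by simp; omega)]

lemma valU_cons (U : ℕ → ℕ) (d : ℕ) (w : List ℕ) :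
    valU U (d :: w) = d * U w.length + valU U w := by
  unfold valU
  rw [List.length_cons, Finset.sum_range_succ, sum_range_cons_eq U d w le_rfl, List.reverse_cons,
    List.getD_append_right _ _ _ _ (by simp)]
  simp [add_comm]

lemma suffixBounded_nil (U : ℕ → ℕ) : SuffixBounded U [] := by
  intro t ht
  simp at ht

lemma SuffixBounded.cons {U : ℕ → ℕ} {d : ℕ} {w : List ℕ} (hw : SuffixBounded U w)
    (h : valU U (d :: w) < U (w.length + 1)) : SuffixBounded U (d :: w) := by
  intro t ht
  rw [List.length_cons] at ht
  rcases Nat.lt_succ_iff_lt_or_eq.1 ht with h' | rfl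
  · rw [sum_range_cons_eq U d w h']
    exact hw t h'
  · exact h

lemma SuffixBounded.valU_lt {U : ℕ → ℕ} (hU : IsNumSys U) {w : List ℕ}
    (hw : SuffixBounded U w) : valU U w < U w.length := by
  rcases w with _ | ⟨d, w⟩
  · simp [valU_nil, hU.base]
  · exact hw w.length (by simp)

lemma SuffixBounded.replicate_zero_append {U : ℕ → ℕ} (hU : IsNumSys U) {w : List ℕ}
    (hw : SuffixBounded U w) (z : ℕ) :
    SuffixBounded U (List.replicate z 0 ++ w) ∧
      valU U (List.replicate z 0 ++ w) = valU U w := by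
  induction z with
  | zero => simpa using hw
  | succ z ih =>
    rw [List.replicate_succ, List.cons_append]
    have hv : valU U (0 :: (List.replicate z 0 ++ w)) = valU U (List.replicate z 0 ++ w) := by
      simp [valU_cons]
    refine ⟨ih.1.cons ?_, hv.trans ih.2⟩
    rw [hv]
    exact (ih.1.valU_lt hU).trans (hU.mono (Nat.lt_succ_self _))

lemma exists_suffixBounded (U : ℕ → ℕ) (hU : IsNumSys U) (L : ℕ) :
    ∀ n < U L, ∃ x : List ℕ, x.length = L ∧ SuffixBounded U x ∧ valU U x = n := by
  induction L with
  | zero =>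
    intro n hn
    rw [hU.base] at hn
    exact ⟨[], rfl, suffixBounded_nil U, by rw [valU_nil]; omega⟩
  | succ L ih =>
    intro n hn
    have hpos : 0 < U L := by
      have := hU.mono.monotone (Nat.zero_le L)
      rw [hU.base] at this
      exact this
    obtain ⟨x, hxl, hx, hxv⟩ := ih (n % U L) (Nat.mod_lt _ hpos)
    have hv : valU U (n / U L :: x) = n := by
      rw [valU_cons, hxl, hxv, mul_comm]
      exact Nat.div_add_mod n (U L)
    exact ⟨n / U L :: x, by simp [hxl], hx.cons (by rw [hv, hxl]; exact hn), hv⟩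

lemma eventually_gap_ge {U : ℕ → ℕ} (h2 : GapsUnbounded U) (h3 : GapsUltNondecreasing U)
    (B : ℕ) : ∃ s₀, ∀ s ≥ s₀, B ≤ U (s + 1) - U s := by
  obtain ⟨G, hG⟩ := h3
  obtain ⟨i, hiG, hi⟩ := Filter.frequently_atTop.1 (h2 B) G
  refine ⟨i, fun s hs => ?_⟩
  induction s, hs using Nat.le_induction with
  | base => exact hi
  | succ s hs ih => exact ih.trans (hG s (hiG.trans hs))

/-- A linear recurrence whose last coefficient is invertible modulo `q` is purely periodic
modulo `q`. -/
lemma exists_period_mod {U : ℕ → ℕ} {k : ℕ} (hk : 1 ≤ k) (a : Fin k → ℤ) {N : ℕ}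
    (hrec : ∀ i ≥ N, (U (i + k) : ℤ) = ∑ j : Fin k, a j * U (i + (j : ℕ)))
    {q : ℕ} [NeZero q] (ha : IsUnit ((a ⟨0, hk⟩ : ℤ) : ZMod q)) :
    ∃ P, 0 < P ∧ ∀ m, (U (N + m * P) : ZMod q) = U N := by
  let v : ℕ → Fin k → ZMod q := fun i j => (U (i + (j : ℕ)) : ZMod q)
  let T : (Fin k → ZMod q) → Fin k → ZMod q := fun x j =>
    if h : (j : ℕ) + 1 < k then x ⟨j + 1, h⟩ else ∑ l : Fin k, (a l : ZMod q) * x l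
  have hT : ∀ i, T^[i] (v N) = v (N + i) := by
    intro i
    induction i with
    | zero => rfl
    | succ i ih =>
      rw [Function.iterate_succ_apply', ih]
      funext j
      by_cases h : (j : ℕ) + 1 < k
      · simp only [T, v, dif_pos h]
        congr 2
        omega
      · have hj : N + (i + 1) + (j : ℕ) = N + i + k := by have := j.2; omega
        have := congrArg (Int.cast : ℤ → ZMod q) (hrec (N + i) (by omega))
        push_cast at this
        simp only [T, v, dif_neg h, hj, this]
  have hinj : Function.Injective T := by
    intro x y hxy
    have hne : ∀ l : Fin k, l ≠ ⟨0, hk⟩ → x l = y l := by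
      intro l hl
      have hl0 : (l : ℕ) ≠ 0 := fun h => hl (Fin.ext h)
      have hlk := l.2
      have h := congrFun hxy ⟨l - 1, by omega⟩
      have hlt : (l : ℕ) - 1 + 1 < k := by omega
      simp only [T, dif_pos hlt] at h
      have hl' : (⟨(l : ℕ) - 1 + 1, hlt⟩ : Fin k) = l := Fin.ext (by simp; omega)
      rwa [hl'] at h
    have hlast := congrFun hxy ⟨k - 1, by omega⟩
    have hnlt : ¬ (k - 1 + 1 < k) := by omega
    simp only [T, dif_neg hnlt] at hlast
    rw [← Finset.add_sum_erase _ _ (Finset.mem_univ (⟨0, hk⟩ : Fin k)),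
      ← Finset.add_sum_erase _ _ (Finset.mem_univ (⟨0, hk⟩ : Fin k)),
      Finset.sum_congr rfl fun l hl => by rw [hne l (Finset.ne_of_mem_erase hl)]] at hlast
    have h0 := ha.mul_left_cancel (add_right_cancel hlast)
    funext l
    by_cases hl : l = ⟨0, hk⟩
    · rw [hl, h0]
    · exact hne l hl
  obtain ⟨P, hP, hper⟩ := hinj.mem_periodicPts (v N)
  refine ⟨P, hP, fun m => ?_⟩
  have h := congrFun ((hT (m * P)).symm.trans (hper.const_mul m)) ⟨0, hk⟩
  simpa [v] using h

/-- Words with `n` digits `1`, far apart, that stay greedy when followed by a word of length `L`. -/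
lemma exists_prefix {U : ℕ → ℕ} (hU : IsNumSys U) (h2 : GapsUnbounded U)
    (h3 : GapsUltNondecreasing U) {q N P : ℕ} (hP : 0 < P)
    (hper : ∀ m, (U (N + m * P) : ZMod q) = U N) (L n : ℕ) :
    ∃ (W : List ℕ) (V : ℕ), (n ≠ 0 → W.head? = some 1) ∧ (V : ZMod q) = n * U N ∧
      ∀ x : List ℕ, x.length = L → SuffixBounded U x →
        SuffixBounded U (W ++ x) ∧ valU U (W ++ x) = V + valU U x := by
  induction n with
  | zero => exact ⟨[], 0, by simp, by simp, fun x _ hx => by simpa using hx⟩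
  | succ n ih =>
    obtain ⟨W, V, -, hV, hW⟩ := ih
    obtain ⟨s₀, hs₀⟩ := eventually_gap_ge h2 h3 (U (W.length + L))
    set m := s₀ + W.length + L with hm
    have hmP : m ≤ m * P := Nat.le_mul_of_pos_right m hP
    have hgap := hs₀ (N + m * P) (by omega)
    obtain ⟨z, hz⟩ : ∃ z, N + m * P = z + (W.length + L) :=
      ⟨N + m * P - (W.length + L), by omega⟩
    refine ⟨1 :: (List.replicate z 0 ++ W), U (N + m * P) + V, by simp, ?_, ?_⟩
    · push_cast
      rw [hper, hV]
      ring
    · intro x hxL hx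
      obtain ⟨hWx, hval⟩ := hW x hxL hx
      obtain ⟨hz1, hz2⟩ := hWx.replicate_zero_append hU z
      have hlen : (List.replicate z 0 ++ (W ++ x)).length = N + m * P := by
        simp [hxL, hz]
      have hv : valU U (1 :: (List.replicate z 0 ++ (W ++ x))) =
          U (N + m * P) + V + valU U x := by
        rw [valU_cons, hlen, hz2, hval]
        ring
      have hlt := hWx.valU_lt hU
      rw [hval, List.length_append, hxL] at hlt
      simp only [List.cons_append, List.append_assoc]
      refine ⟨hz1.cons ?_, hv⟩
      rw [hv, hlen]
      omega

lemma PeriodFrom.mul {X : Set ℕ} {a π : ℕ} (h : PeriodFrom X a π) {n : ℕ} (hn : a ≤ n) (t : ℕ) :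
    n ∈ X ↔ n + π * t ∈ X := by
  induction t with
  | zero => simp
  | succ t ih => rw [ih, h (n + π * t) (by omega), Nat.mul_succ, add_assoc]

lemma HasMinPeriod.dvd {X : Set ℕ} {π D b : ℕ} (hX : HasMinPeriod X π)
    (hD : PeriodFrom X b D) : π ∣ D := by
  obtain ⟨hπ, ⟨a, ha⟩, hmin⟩ := hX
  by_contra hnd
  have hpos : 1 ≤ D % π := Nat.pos_of_ne_zero fun h => hnd (Nat.dvd_of_mod_eq_zero h)
  have hle := hmin (D % π) hpos ⟨max a b, fun n hn => by
    rw [hD n (le_of_max_le_right hn),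
      ha.mul (n := n + D % π) ((le_of_max_le_left hn).trans (Nat.le_add_right _ _)) (D / π),
      add_assoc, Nat.mod_add_div]⟩
  exact absurd hle (Nat.not_le.2 (Nat.mod_lt _ hπ))

/-- If two translates of `X` agree on a window of one period beyond the preperiod, the difference
of the translations is a multiple of the period. -/
lemma HasMinPeriod.dvd_sub {X : Set ℕ} {π a V V' : ℕ} (hX : HasMinPeriod X π)
    (ha : PeriodFrom X a π) (hle : V ≤ V')
    (h : ∀ n < a + π, (V + n ∈ X ↔ V' + n ∈ X)) : π ∣ V' - V := by
  refine hX.dvd (b := V + a) fun n hn => ?_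
  have hmod := Nat.mod_lt (n - V - a) hX.1
  have hdiv := Nat.mod_add_div (n - V - a) π
  set ρ := (n - V - a) % π
  have h1 := ha.mul (n := V + (a + ρ)) (by omega) ((n - V - a) / π)
  have h2 := ha.mul (n := V' + (a + ρ)) (by omega) ((n - V - a) / π)
  rw [show V + (a + ρ) + π * ((n - V - a) / π) = n by omega] at h1
  rw [show V' + (a + ρ) + π * ((n - V - a) / π) = n + (V' - V) by omega] at h2
  rw [← h1, ← h2, h (a + ρ) (by omega)]

/-- Let `U` be a numeration system satisfying (H1), (H2), (H3), linear
with coefficients `a 0, …, a (k-1)`. Let `p` be a prime with `p > max {|a₀|, U N}`. If `X` is ultimately periodic of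
period `p^μ * r` with `μ ≥ 1` and `p ∤ r`, then every DFA accepting `rep_U(X)` has at
least `p^μ` states. -/
theorem stmt7 (U : ℕ → ℕ) (hU : IsNumSys U)
    (h1 : IsRegularLang {w : List ℕ | IsGreedyRep U w})
    (h2 : GapsUnbounded U) (h3 : GapsUltNondecreasing U)
    (k : ℕ) (hk : 1 ≤ k) (a : Fin k → ℤ) (ha0 : a ⟨0, hk⟩ ≠ 0) (N : ℕ)
    (hrec : ∀ i ≥ N, (U (i + k) : ℤ) = ∑ j : Fin k, a j * U (i + (j : ℕ)))
    (p : ℕ) (hp : p.Prime) (hpbig : max (a ⟨0, hk⟩).natAbs (U N) < p)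
    (X : Set ℕ) (μ r : ℕ) (hμ : 1 ≤ μ) (hr : ¬ p ∣ r)
    (hX : HasMinPeriod X (p ^ μ * r))
    (σ : Type) [Fintype σ] (M : DFA ℕ σ) (hM : M.accepts = repLang U X) :
    p ^ μ ≤ Fintype.card σ := by
  have hq : p ^ μ ≠ 0 := pow_ne_zero _ hp.ne_zero
  have : NeZero (p ^ μ) := ⟨hq⟩
  have hUN : 0 < U N := by
    have := hU.mono.monotone (Nat.zero_le N)
    rw [hU.base] at this
    exact this
  have hunit : ∀ n : ℕ, 0 < n → n < p → IsUnit (n : ZMod (p ^ μ)) := fun n h0 hn =>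
    (ZMod.isUnit_iff_coprime n (p ^ μ)).2
      ((Nat.coprime_of_lt_prime h0.ne' hn hp).symm.pow_right μ)
  have haunit : IsUnit ((a ⟨0, hk⟩ : ℤ) : ZMod (p ^ μ)) := by
    have h := hunit _ (Int.natAbs_pos.2 ha0) (lt_of_le_of_lt (le_max_left _ _) hpbig)
    rcases Int.natAbs_eq (a ⟨0, hk⟩) with h' | h' <;> rw [h']
    · simpa using h
    · simpa using h
  obtain ⟨P, hP, hper⟩ := exists_period_mod hk a hrec haunit
  obtain ⟨b, hb⟩ := hX.2.1
  set L := b + p ^ μ * r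
  choose W V hW1 hV hW using fun n : ℕ => exists_prefix hU h2 h3 hP hper L n
  have key : ∀ m m' : ℕ, m ≠ 0 → m' ≠ 0 → M.eval (W m) = M.eval (W m') →
      V m ≤ V m' → (m : ZMod (p ^ μ)) = m' := by
    intro m m' hm hm' heq hle
    have hmem : ∀ n ≠ 0, ∀ x : List ℕ, x.length = L → SuffixBounded U x →
        (W n ++ x ∈ M.accepts ↔ V n + valU U x ∈ X) := by
      intro n hn x hxL hx
      obtain ⟨hs, hv⟩ := hW n x hxL hx
      have hhead : (W n ++ x).head? ≠ some 0 := by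
        rw [List.head?_append, hW1 n hn]
        simp
      rw [hM, ← hv]
      exact ⟨fun h => h.2, fun h => ⟨⟨hhead, hs⟩, h⟩⟩
    have hdvd : p ^ μ * r ∣ V m' - V m := by
      refine hX.dvd_sub hb hle fun n hn => ?_
      obtain ⟨x, hxL, hx, rfl⟩ :=
        exists_suffixBounded U hU L n (hn.trans_le hU.mono.le_apply)
      rw [← hmem m hm x hxL hx, ← hmem m' hm' x hxL hx, DFA.mem_accepts, DFA.mem_accepts]
      change M.evalFrom M.start (W m ++ x) ∈ _ ↔ M.evalFrom M.start (W m' ++ x) ∈ _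
      rw [DFA.evalFrom_of_append, DFA.evalFrom_of_append]
      change M.evalFrom (M.eval (W m)) x ∈ _ ↔ M.evalFrom (M.eval (W m')) x ∈ _
      rw [heq]
    have hcast : (V m : ZMod (p ^ μ)) = V m' := by
      have h0 := (ZMod.natCast_eq_zero_iff (V m' - V m) (p ^ μ)).2
        ((Dvd.intro r rfl).trans hdvd)
      rw [Nat.cast_sub hle] at h0
      exact (sub_eq_zero.1 h0).symm
    rw [hV, hV] at hcast
    exact (hunit _ hUN (lt_of_le_of_lt (le_max_right _ _) hpbig)).mul_right_cancel hcast
  have hinj : Function.Injective fun m : Fin (p ^ μ) => M.eval (W (m + 1)) := by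
    intro m m' heq
    have h : (((m : ℕ) + 1 : ℕ) : ZMod (p ^ μ)) = (((m' : ℕ) + 1 : ℕ) : ZMod (p ^ μ)) := by
      rcases le_total (V (m + 1)) (V (m' + 1)) with hle | hle
      · exact key _ _ (by omega) (by omega) heq hle
      · exact (key _ _ (by omega) (by omega) heq.symm hle).symm
    push_cast at h
    have h' := (ZMod.natCast_eq_natCast_iff' _ _ _).1 (add_right_cancel h)
    rw [Nat.mod_eq_of_lt m.2, Nat.mod_eq_of_lt m'.2] at h'
    exact Fin.ext h'
  simpa using Fintype.card_le_of_injective _ hinj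
end

section
/- Let X ⊆ ℕ be an ultimately periodic set whose period factors as π_X = Q·p_1^{μ_1}⋯p_t^{μ_t}, where p_1,…,p_t are distinct primes none of which divides Q and each μ_j ≥ 1. Then there exists r ∈ {0,…,Q−1} such that X ∩ (Qℕ + r) is ultimately periodic with period of the form Q·p_1^{ν_1}⋯p_t^{ν_t} and max_{1≤j≤t} μ_j = max_{1≤j≤t} ν_j. -/
theorem PeriodFrom.mono {X : Set ℕ} {a b p : ℕ} (h : PeriodFrom X a p) (hab : a ≤ b) :
    PeriodFrom X b p :=
  fun n hn => h n (hab.trans hn)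

theorem PeriodFrom.mul_s9 {X : Set ℕ} {a p : ℕ} (h : PeriodFrom X a p) (k : ℕ) :
    PeriodFrom X a (p * k) := by
  intro n hn
  induction k with
  | zero => simp
  | succ k ih => rw [ih, h (n + p * k) (by omega), Nat.mul_succ, Nat.add_assoc]

theorem PeriodFrom.mod {X : Set ℕ} {a p q : ℕ} (hp : PeriodFrom X a p)
    (hq : PeriodFrom X a q) : PeriodFrom X a (q % p) := by
  intro n hn
  rw [hq n hn, hp.mul_s9 (q / p) (n + q % p) (by omega), Nat.add_assoc, Nat.mod_add_div]

/-- The minimal period divides every period. -/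
theorem HasMinPeriod.dvd_s9 {X : Set ℕ} {a p q : ℕ} (hp : HasMinPeriod X p)
    (hq : PeriodFrom X a q) : p ∣ q := by
  obtain ⟨hpos, ⟨b, hb⟩, hmin⟩ := hp
  by_contra hdvd
  have hmod := (hb.mono (le_max_right a b)).mod (hq.mono (le_max_left a b))
  have hle := hmin (q % p) (by have := mt Nat.dvd_of_mod_eq_zero hdvd; omega) ⟨_, hmod⟩
  exact absurd (Nat.mod_lt q hpos) (by omega)

theorem PeriodFrom.exists_hasMinPeriod {X : Set ℕ} {a q : ℕ} (hq : PeriodFrom X a q)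
    (hpos : 1 ≤ q) : ∃ p, HasMinPeriod X p := by
  classical
  have hex : ∃ p, 1 ≤ p ∧ ∃ a, PeriodFrom X a p := ⟨q, hpos, a, hq⟩
  exact ⟨Nat.find hex, (Nat.find_spec hex).1, (Nat.find_spec hex).2,
    fun p h1 h2 => Nat.find_min' hex ⟨h1, h2⟩⟩

theorem PeriodFrom.inter_residue {X : Set ℕ} {a q Q : ℕ} (hq : PeriodFrom X a q)
    (hQ : Q ∣ q) (r : ℕ) : PeriodFrom (X ∩ {n | n % Q = r}) a q := by
  obtain ⟨k, rfl⟩ := hQ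
  intro n hn
  simp [hq n hn]

/-- A common period of all residue class parts of `X` that is a multiple of the modulus is a
period of `X`. -/
theorem exists_periodFrom_of_inter_residue {X : Set ℕ} {q Q : ℕ} (hpos : 0 < Q) (hQ : Q ∣ q)
    (h : ∀ r < Q, ∃ a, PeriodFrom (X ∩ {n | n % Q = r}) a q) : ∃ a, PeriodFrom X a q := by
  choose! a ha using h
  refine ⟨(Finset.range Q).sup a, fun n hn => ?_⟩
  have hr := Nat.mod_lt n hpos
  have hle : a (n % Q) ≤ n := (Finset.le_sup (Finset.mem_range.2 hr)).trans hn
  have key := ha _ hr n hle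
  obtain ⟨k, rfl⟩ := hQ
  simpa using key

/-- A period of an infinite part of a residue class is a multiple of the modulus; otherwise every
number is a period. -/
theorem PeriodFrom.dvd_or_forall_periodFrom {X : Set ℕ} {a p Q r : ℕ}
    (hp : PeriodFrom (X ∩ {n | n % Q = r}) a p) :
    Q ∣ p ∨ ∀ q, PeriodFrom (X ∩ {n | n % Q = r}) a q := by
  by_cases hne : ∃ n, a ≤ n ∧ n ∈ X ∩ {n | n % Q = r}
  · obtain ⟨n, han, hn⟩ := hne
    have h1 : n % Q = r := hn.2
    have h2 : (n + p) % Q = r := ((hp n han).1 hn).2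
    have hmod : n + 0 ≡ n + p [MOD Q] := h1.trans h2.symm
    exact .inl ((Nat.modEq_zero_iff_dvd).1 (Nat.ModEq.add_left_cancel' n hmod).symm)
  · push Not at hne
    exact .inr fun q n hn => iff_of_false (hne n hn) (hne (n + q) (by omega))

theorem Nat.exists_eq_prod_pow_of_dvd_prod_pow {ι : Type*} {s : Finset ι} {p μ : ι → ℕ}
    (hp : ∀ j, (p j).Prime) {e : ℕ} (he : e ∣ ∏ j ∈ s, p j ^ μ j) :
    ∃ ν : ι → ℕ, ν ≤ μ ∧ e = ∏ j ∈ s, p j ^ ν j := by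
  classical
  induction s using Finset.induction_on generalizing e with
  | empty => exact ⟨μ, le_rfl, by simpa using he⟩
  | insert i s hi ih =>
    rw [Finset.prod_insert hi] at he
    obtain ⟨x, y, hx, hy, rfl⟩ := (Nat.dvd_mul).1 he
    obtain ⟨k, hk, rfl⟩ := (Nat.dvd_prime_pow (hp i)).1 hx
    obtain ⟨ν, hν, rfl⟩ := ih hy
    refine ⟨Function.update ν i k, update_le_iff.2 ⟨hk, fun j _ => hν j⟩, ?_⟩
    rw [Finset.prod_insert hi, Function.update_self]
    congr 1
    refine Finset.prod_congr rfl fun j hj => ?_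
    rw [Function.update_of_ne (ne_of_mem_of_not_mem hj hi)]

/-- Honkala's lemma. If `X` is ultimately periodic with period
`Q * ∏ p j ^ μ j`, where the `p j` are distinct primes not dividing `Q` and each
`μ j ≥ 1`, then there is `r < Q` such that `X ∩ (Qℕ + r)` is ultimately periodic with
period of the form `Q * ∏ p j ^ ν j` and `max μ = max ν`. -/
theorem stmt9 (X : Set ℕ) (t : ℕ) (ht : 1 ≤ t) (Q : ℕ)
    (p : Fin t → ℕ) (μ : Fin t → ℕ)
    (hp : ∀ j, (p j).Prime) (hinj : Function.Injective p)
    (hpQ : ∀ j, ¬ p j ∣ Q) (hμ : ∀ j, 1 ≤ μ j)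
    (hX : HasMinPeriod X (Q * ∏ j, p j ^ μ j)) :
    ∃ r < Q, ∃ ν : Fin t → ℕ,
      HasMinPeriod (X ∩ {n : ℕ | n % Q = r}) (Q * ∏ j, p j ^ ν j) ∧
      Finset.univ.sup μ = Finset.univ.sup ν := by
  have hN := hX.1
  have hQ : 0 < Q := Nat.pos_of_ne_zero (by rintro rfl; simp at hN)
  obtain ⟨a, ha⟩ := hX.2.1
  obtain ⟨i, -, hi⟩ := Finset.exists_mem_eq_sup Finset.univ ⟨⟨0, ht⟩, Finset.mem_univ _⟩ μ
  set μ' := Function.update μ i (μ i - 1) with hμ'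
  have hprod : ∏ j, p j ^ μ j = p i * ∏ j, p j ^ μ' j := by
    rw [← Finset.mul_prod_erase _ _ (Finset.mem_univ i),
      ← Finset.mul_prod_erase _ (fun j => p j ^ μ' j) (Finset.mem_univ i), ← mul_assoc]
    congr 1
    · rw [hμ', Function.update_self, mul_pow_sub_one (by have := hμ i; omega)]
    · refine Finset.prod_congr rfl fun j hj => ?_
      rw [hμ', Function.update_of_ne (Finset.ne_of_mem_erase hj)]
  have hM' : 0 < Q * ∏ j, p j ^ μ' j :=
    Nat.mul_pos hQ (Finset.prod_pos fun j _ => pow_pos (hp j).pos _)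
  have hnot : ¬ ∃ a, PeriodFrom X a (Q * ∏ j, p j ^ μ' j) := by
    intro h
    have hle := hX.2.2 _ hM' h
    rw [hprod, mul_left_comm] at hle
    nlinarith [(hp i).two_le]
  obtain ⟨r, hr, hrnot⟩ : ∃ r < Q,
      ¬ ∃ a, PeriodFrom (X ∩ {n | n % Q = r}) a (Q * ∏ j, p j ^ μ' j) := by
    by_contra! h
    exact hnot (exists_periodFrom_of_inter_residue hQ (dvd_mul_right _ _) h)
  have hr_period := ha.inter_residue (dvd_mul_right _ _) r
  obtain ⟨d, hd⟩ := hr_period.exists_hasMinPeriod hN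
  obtain ⟨b, hb⟩ := hd.2.1
  obtain ⟨e, rfl⟩ : Q ∣ d :=
    hb.dvd_or_forall_periodFrom.resolve_right fun h => hrnot ⟨b, h _⟩
  obtain ⟨ν, hν, rfl⟩ := Nat.exists_eq_prod_pow_of_dvd_prod_pow hp
    (Nat.dvd_of_mul_dvd_mul_left hQ (hd.dvd_s9 hr_period))
  refine ⟨r, hr, ν, hd, le_antisymm ?_ (Finset.sup_mono_fun fun j _ => hν j)⟩
  rw [hi]
  refine le_trans ?_ (Finset.le_sup (Finset.mem_univ i))
  by_contra! hlt
  have hν' : ν ≤ μ' := le_update_iff.2 ⟨by omega, fun j _ => hν j⟩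
  obtain ⟨k, hk⟩ : Q * ∏ j, p j ^ ν j ∣ Q * ∏ j, p j ^ μ' j :=
    mul_dvd_mul_left Q (Finset.prod_dvd_prod_of_dvd _ _ fun j _ => pow_dvd_pow _ (hν' j))
  exact hrnot ⟨b, hk ▸ hb.mul_s9 k⟩
end
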